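/- Let n ≥ 2 and 1 ≤ m < n, and let either p ∈ (1, n/m) and q ∈ [1,∞], or p = q = 1. Then there exists a constant C > 0 such that for every m-times continuously differentiable function u : ℝ^n → ℝ satisfying |{x ∈ ℝ^n : |∇^k u(x)| > λ}| < ∞ for every λ > 0 and every k ∈ {0,1,…,m−1} (in particular for every u ∈ C_c^∞(ℝ^n)), one has ‖u‖_{L^{np/(n−mp), q}(ℝ^n)} ≤ C ‖∇^m u‖_{L^{p,q}(ℝ^n)}, i.e. ‖t^{(n−mp)/(np) − 1/q} u^*(t)‖_{L^q(0,∞)} ≤ C ‖t^{1/p − 1/q} (|∇^m u|)^*(t)‖_{L^q(0,∞)}. In particular, taking q = p, ‖u‖_{L^{np/(n−mp), p}(ℝ^n)} ≤ C ‖∇^m u‖_{L^p(ℝ^n)}. -/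

import Mathlib

open MeasureTheory Set Filter
open scoped ENNReal NNReal Topology

noncomputable section

/-- Lebesgue measure restricted to `(0,∞)`. -/
def mu0 : Measure ℝ := volume.restrict (Set.Ioi (0:ℝ))

/-- Decreasing rearrangement of an `ℝ≥0∞`-valued function w.r.t. a measure `μ`. -/
def rearrangement {α : Type*} [MeasurableSpace α] (μ : Measure α) (f : α → ℝ≥0∞) (t : ℝ) :
    ℝ≥0∞ :=
  sInf {l : ℝ≥0∞ | μ {x | l < f x} ≤ ENNReal.ofReal t}

/-- Decreasing rearrangement of a (nonnegative) function on `(0,∞)`. -/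
def rearr (f : ℝ → ℝ≥0∞) : ℝ → ℝ≥0∞ := rearrangement mu0 f

/-- The maximal rearrangement `f^{**}(t) = (1/t)∫_0^t f^*(s) ds`. -/
def doubleStar (f : ℝ → ℝ≥0∞) (t : ℝ) : ℝ≥0∞ :=
  (ENNReal.ofReal t)⁻¹ * ∫⁻ s in Set.Ioc (0:ℝ) t, rearr f s

/-- Rearrangement-invariant function norm on `(0,∞)` (axioms (P1)–(P6)). -/
structure IsRINorm (ρ : (ℝ → ℝ≥0∞) → ℝ≥0∞) : Prop where
  eq_zero_iff : ∀ f : ℝ → ℝ≥0∞, Measurable f → (ρ f = 0 ↔ f =ᵐ[mu0] 0)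
  smul : ∀ (c : ℝ≥0) (f : ℝ → ℝ≥0∞), Measurable f →
    ρ (fun t => (c : ℝ≥0∞) * f t) = c * ρ f
  triangle : ∀ f g : ℝ → ℝ≥0∞, Measurable f → Measurable g → ρ (f + g) ≤ ρ f + ρ g
  mono : ∀ f g : ℝ → ℝ≥0∞, Measurable f → Measurable g →
    (∀ᵐ t ∂mu0, f t ≤ g t) → ρ f ≤ ρ g
  fatou : ∀ (F : ℕ → ℝ → ℝ≥0∞) (f : ℝ → ℝ≥0∞), (∀ j, Measurable (F j)) → Measurable f →
    (∀ j t, F j t ≤ F (j + 1) t) → (∀ t, (⨆ j, F j t) = f t) → (⨆ j, ρ (F j)) = ρ f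
  indicator_lt_top : ∀ E : Set ℝ, MeasurableSet E → mu0 E < ∞ → ρ (E.indicator 1) < ∞
  local_L1 : ∀ E : Set ℝ, MeasurableSet E → mu0 E < ∞ → ∃ C : ℝ≥0∞, 0 < C ∧ C < ∞ ∧
    ∀ f : ℝ → ℝ≥0∞, Measurable f → (∫⁻ t in E, f t ∂mu0) ≤ C * ρ f
  rearr_inv : ∀ f g : ℝ → ℝ≥0∞, Measurable f → Measurable g → rearr f = rearr g → ρ f = ρ g

/-- The associate norm `ρ'`. -/
def associate (ρ : (ℝ → ℝ≥0∞) → ℝ≥0∞) (g : ℝ → ℝ≥0∞) : ℝ≥0∞ :=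
  ⨆ (f : ℝ → ℝ≥0∞) (_ : Measurable f) (_ : ρ f ≤ 1), ∫⁻ t, f t * g t ∂mu0

/-- The weighted Hardy-type operator `f ↦ (t ↦ ∫_t^∞ f(s) s^{m/n-1} ds)`. -/
def hardyOp (m n : ℕ) (f : ℝ → ℝ≥0∞) (t : ℝ) : ℝ≥0∞ :=
  ∫⁻ s in Set.Ioi t, f s * ENNReal.ofReal (s ^ ((m : ℝ)/(n : ℝ) - 1))

/-- The function `t ↦ t^{m/n-1} χ_{(1,∞)}(t)`. -/
def tailFun (m n : ℕ) (t : ℝ) : ℝ≥0∞ :=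
  ENNReal.ofReal (t ^ ((m : ℝ)/(n : ℝ) - 1)) * (Set.Ioi (1:ℝ)).indicator 1 t

/-- The functional `σ_m(f) = ρ'(t ↦ t^{m/n} f^{**}(t))`. -/
def sigmaFun (m n : ℕ) (ρ : (ℝ → ℝ≥0∞) → ℝ≥0∞) (f : ℝ → ℝ≥0∞) : ℝ≥0∞ :=
  associate ρ (fun t => ENNReal.ofReal (t ^ ((m : ℝ)/(n : ℝ))) * doubleStar f t)

/-- The optimal-domain functional `τ_m`. -/
def tauFun (m n : ℕ) (ρY : (ℝ → ℝ≥0∞) → ℝ≥0∞) (f : ℝ → ℝ≥0∞) : ℝ≥0∞ :=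
  ⨆ (h : ℝ → ℝ≥0∞) (_ : Measurable h) (_ : rearr h = rearr f), ρY (hardyOp m n h)

/-- The operator `T_α f(t) = t^{-α} sup_{t ≤ s} s^α f^*(s)`. -/
def supOp (α : ℝ) (f : ℝ → ℝ≥0∞) (t : ℝ) : ℝ≥0∞ :=
  ENNReal.ofReal (t ^ (-α)) * ⨆ (s : ℝ) (_ : t ≤ s), ENNReal.ofReal (s ^ α) * rearr f s

/-- `σ` is an optimal (smallest) rearrangement-invariant target norm for `ρX` in the
Hardy-type inequality `‖∫_t^∞ f(s) s^{m/n-1} ds‖_Y ≤ C ‖f‖_X`. -/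
def IsOptimalTargetNorm (m n : ℕ) (ρX σ : (ℝ → ℝ≥0∞) → ℝ≥0∞) : Prop :=
  (∃ C : ℝ≥0∞, 0 < C ∧ C < ∞ ∧
      ∀ f : ℝ → ℝ≥0∞, Measurable f → σ (hardyOp m n f) ≤ C * ρX f) ∧
  ∀ ρZ : (ℝ → ℝ≥0∞) → ℝ≥0∞, IsRINorm ρZ →
    (∃ C : ℝ≥0∞, 0 < C ∧ C < ∞ ∧
       ∀ f : ℝ → ℝ≥0∞, Measurable f → ρZ (hardyOp m n f) ≤ C * ρX f) →
    ∃ c : ℝ≥0∞, 0 < c ∧ c < ∞ ∧ ∀ f : ℝ → ℝ≥0∞, Measurable f → ρZ f ≤ c * σ f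

/-- There exists a rearrangement-invariant target norm for `ρX` in the Hardy-type
inequality. -/
def ExistsRITarget (m n : ℕ) (ρX : (ℝ → ℝ≥0∞) → ℝ≥0∞) : Prop :=
  ∃ (ρY : (ℝ → ℝ≥0∞) → ℝ≥0∞) (C : ℝ≥0∞), IsRINorm ρY ∧ 0 < C ∧ C < ∞ ∧
    ∀ f : ℝ → ℝ≥0∞, Measurable f → ρY (hardyOp m n f) ≤ C * ρX f

/-- There exists a rearrangement-invariant domain norm for `ρY` in the Hardy-type
inequality. -/
def ExistsRIDomain (m n : ℕ) (ρY : (ℝ → ℝ≥0∞) → ℝ≥0∞) : Prop :=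
  ∃ (ρX : (ℝ → ℝ≥0∞) → ℝ≥0∞) (C : ℝ≥0∞), IsRINorm ρX ∧ 0 < C ∧ C < ∞ ∧
    ∀ f : ℝ → ℝ≥0∞, Measurable f → ρY (hardyOp m n f) ≤ C * ρX f

/-- Two functionals are equivalent with constants independent of the function. -/
def EquivNorms (σ τ : (ℝ → ℝ≥0∞) → ℝ≥0∞) : Prop :=
  ∃ c C : ℝ≥0∞, 0 < c ∧ c < ∞ ∧ 0 < C ∧ C < ∞ ∧
    ∀ f : ℝ → ℝ≥0∞, Measurable f → c * σ f ≤ τ f ∧ τ f ≤ C * σ f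

/-- The decay condition defining `V_0^m X(ℝ^n)`: all derivatives of order `< m` have
finite-measure superlevel sets. -/
def DecaysAtInfinity (n m : ℕ) (u : EuclideanSpace ℝ (Fin n) → ℝ) : Prop :=
  ∀ k : ℕ, k < m → ∀ lam : ℝ, 0 < lam →
    volume {x : EuclideanSpace ℝ (Fin n) | lam < ‖iteratedFDeriv ℝ k u x‖} < ∞

/-- Broken logarithm `ℓ^{[a₀,a_∞]}`. -/
def ell (a0 ai : ℝ) (t : ℝ) : ℝ :=
  if t < 1 then (1 - Real.log t) ^ a0 else (1 + Real.log t) ^ ai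

/-- Doubly broken logarithm `ℓℓ^{[b₀,b_∞]}`. -/
def ell2 (b0 bi : ℝ) (t : ℝ) : ℝ :=
  if t < 1 then (1 + Real.log (1 - Real.log t)) ^ b0
  else (1 + Real.log (1 + Real.log t)) ^ bi

/-- Triply broken logarithm `ℓℓℓ^{[c₀,c_∞]}`. -/
def ell3 (c0 ci : ℝ) (t : ℝ) : ℝ :=
  if t < 1 then (1 + Real.log (1 + Real.log (1 - Real.log t))) ^ c0
  else (1 + Real.log (1 + Real.log (1 + Real.log t))) ^ ci

/-- `L^q`-functional (`q ∈ [1,∞]`) of an `ℝ≥0∞`-valued function over `S ⊆ ℝ`. -/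
def Lqnorm (q : ℝ≥0∞) (S : Set ℝ) (g : ℝ → ℝ≥0∞) : ℝ≥0∞ :=
  if q = ∞ then essSup g (volume.restrict S)
  else (∫⁻ t in S, g t ^ q.toReal) ^ (1 / q.toReal)

/-- Lorentz–Zygmund functional `‖f‖_{p,q;[a₀,a_∞]}`, parametrized by `pinv = 1/p`. -/
def LZnorm (pinv : ℝ) (q : ℝ≥0∞) (a0 ai : ℝ) (f : ℝ → ℝ≥0∞) : ℝ≥0∞ :=
  Lqnorm q (Set.Ioi 0)
    (fun t => ENNReal.ofReal (t ^ (pinv - q⁻¹.toReal) * ell a0 ai t) * rearr f t)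

/-- Generalized Lorentz–Zygmund functional with two tiers of logarithms. -/
def GLZnorm2 (pinv : ℝ) (q : ℝ≥0∞) (a0 ai b0 bi : ℝ) (f : ℝ → ℝ≥0∞) : ℝ≥0∞ :=
  Lqnorm q (Set.Ioi 0)
    (fun t => ENNReal.ofReal (t ^ (pinv - q⁻¹.toReal) * ell a0 ai t * ell2 b0 bi t) * rearr f t)

/-- Generalized Lorentz–Zygmund functional with three tiers of logarithms. -/
def GLZnorm3 (pinv : ℝ) (q : ℝ≥0∞) (a0 ai b0 bi c0 ci : ℝ) (f : ℝ → ℝ≥0∞) : ℝ≥0∞ :=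
  Lqnorm q (Set.Ioi 0)
    (fun t => ENNReal.ofReal
      (t ^ (pinv - q⁻¹.toReal) * ell a0 ai t * ell2 b0 bi t * ell3 c0 ci t) * rearr f t)

/-- Young function predicate. -/
structure IsYoung (A : ℝ → ℝ≥0∞) : Prop where
  map_zero : A 0 = 0
  convex : ∀ x y : ℝ, 0 ≤ x → 0 ≤ y → ∀ l : ℝ, 0 ≤ l → l ≤ 1 →
    A (l * x + (1 - l) * y) ≤ ENNReal.ofReal l * A x + ENNReal.ofReal (1 - l) * A y
  left_cont : ∀ x : ℝ, 0 < x → Filter.Tendsto A (nhdsWithin x (Set.Iio x)) (nhds (A x))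
  not_zero : ∃ x : ℝ, 0 < x ∧ A x ≠ 0
  not_top : ∃ x : ℝ, 0 < x ∧ A x ≠ ∞

/-- Canonical extension of a Young function to `ℝ≥0∞`-valued arguments. -/
def eext (A : ℝ → ℝ≥0∞) (x : ℝ≥0∞) : ℝ≥0∞ := if x = ∞ then ∞ else A x.toReal

/-- Luxemburg norm on `(0,∞)`. -/
def luxNorm (A : ℝ → ℝ≥0∞) (f : ℝ → ℝ≥0∞) : ℝ≥0∞ :=
  sInf {l : ℝ≥0∞ | l ≠ 0 ∧ (∫⁻ t in Set.Ioi (0:ℝ), eext A (f t / l)) ≤ 1}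

/-- Generalized (right-continuous) inverse of a nondecreasing `g : ℝ → ℝ≥0∞`. -/
def geninv (g : ℝ → ℝ≥0∞) (y : ℝ≥0∞) : ℝ≥0∞ :=
  ⨅ (s : ℝ) (_ : 0 ≤ s) (_ : y ≤ g s), ENNReal.ofReal s

/-- Young conjugate `Ã(t) = sup_{s ≥ 0} (st - A(s))`. -/
def conjY (A : ℝ → ℝ≥0∞) (t : ℝ) : ℝ≥0∞ :=
  ⨆ (s : ℝ) (_ : 0 ≤ s), (ENNReal.ofReal (s * t) - A s)

/-- `h_A(t) = sup_{0<s<∞} A^{-1}(st)/A^{-1}(s)`. -/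
def hYoung (A : ℝ → ℝ≥0∞) (t : ℝ) : ℝ≥0∞ :=
  ⨆ (s : ℝ) (_ : 0 < s), geninv A (ENNReal.ofReal (s * t)) / geninv A (ENNReal.ofReal s)

/-- The upper Boyd index `I_A = inf_{0<t<1} log t / log h_A(t)`. -/
def upperBoyd (A : ℝ → ℝ≥0∞) : ℝ :=
  sInf ((fun t => Real.log t / Real.log ((hYoung A t).toReal)) '' Set.Ioo (0:ℝ) 1)

/-- `H_m(t) = (∫_0^t (s/A(s))^{m/(n-m)} ds)^{(n-m)/n}`. -/
def Hm (m n : ℕ) (A : ℝ → ℝ≥0∞) (t : ℝ) : ℝ≥0∞ :=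
  (∫⁻ s in Set.Ioc (0:ℝ) t, (ENNReal.ofReal s / A s) ^ ((m : ℝ)/((n : ℝ) - (m : ℝ))))
    ^ (((n : ℝ) - (m : ℝ))/(n : ℝ))

/-- `H^∞ = lim_{t→∞} H_m(t)`. -/
def Hinfty (m n : ℕ) (A : ℝ → ℝ≥0∞) : ℝ≥0∞ := ⨆ t : ℝ, Hm m n A t

/-- `D_m`. -/
def Dm (m n : ℕ) (A : ℝ → ℝ≥0∞) (t : ℝ) : ℝ≥0∞ :=
  if ENNReal.ofReal t < Hinfty m n A then
    (ENNReal.ofReal t * A ((geninv (Hm m n A) (ENNReal.ofReal t)).toReal) /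
        geninv (Hm m n A) (ENNReal.ofReal t)) ^ ((n : ℝ)/((n : ℝ) - (m : ℝ)))
  else ∞

/-- `A_m(t) = ∫_0^t D_m(s)/s ds`. -/
def Am (m n : ℕ) (A : ℝ → ℝ≥0∞) (t : ℝ) : ℝ≥0∞ :=
  ∫⁻ s in Set.Ioc (0:ℝ) t, Dm m n A s / ENNReal.ofReal s

/-- `G_m(t) = t · inf_{0<s≤t} B^{-1}(s) s^{(m-n)/n}`. -/
def Gm (m n : ℕ) (B : ℝ → ℝ≥0∞) (t : ℝ) : ℝ≥0∞ :=
  ENNReal.ofReal t *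
    ⨅ (s : ℝ) (_ : 0 < s) (_ : s ≤ t),
      geninv B (ENNReal.ofReal s) * ENNReal.ofReal (s ^ (((m : ℝ) - (n : ℝ))/(n : ℝ)))

/-- `B_m(t) = ∫_0^t G_m^{-1}(s)/s ds`. -/
def Bm (m n : ℕ) (B : ℝ → ℝ≥0∞) (t : ℝ) : ℝ≥0∞ :=
  ∫⁻ s in Set.Ioc (0:ℝ) t, geninv (Gm m n B) (ENNReal.ofReal s) / ENNReal.ofReal s

/-- `A` dominates `B` near zero. -/
def DomNearZero (A B : ℝ → ℝ≥0∞) : Prop :=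
  ∃ c t0 : ℝ, 0 < c ∧ 0 < t0 ∧ ∀ t : ℝ, 0 ≤ t → t ≤ t0 → B t ≤ A (c * t)

/-- `A` dominates `B` near infinity. -/
def DomNearInfty (A B : ℝ → ℝ≥0∞) : Prop :=
  ∃ c t0 : ℝ, 0 < c ∧ 0 < t0 ∧ ∀ t : ℝ, t0 ≤ t → B t ≤ A (c * t)

def EquivNearZero (A B : ℝ → ℝ≥0∞) : Prop := DomNearZero A B ∧ DomNearZero B A

def EquivNearInfty (A B : ℝ → ℝ≥0∞) : Prop := DomNearInfty A B ∧ DomNearInfty B A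

/-- There exists an Orlicz target for the Hardy-type inequality with domain `L^A`. -/
def ExistsOrliczTarget (m n : ℕ) (A : ℝ → ℝ≥0∞) : Prop :=
  ∃ B : ℝ → ℝ≥0∞, IsYoung B ∧ ∃ C : ℝ≥0∞, 0 < C ∧ C < ∞ ∧
    ∀ f : ℝ → ℝ≥0∞, Measurable f → luxNorm B (hardyOp m n f) ≤ C * luxNorm A f

/-- There exists an Orlicz domain for the Hardy-type inequality with target `L^B`. -/
def ExistsOrliczDomain (m n : ℕ) (B : ℝ → ℝ≥0∞) : Prop :=
  ∃ A : ℝ → ℝ≥0∞, IsYoung A ∧ ∃ C : ℝ≥0∞, 0 < C ∧ C < ∞ ∧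
    ∀ f : ℝ → ℝ≥0∞, Measurable f → luxNorm B (hardyOp m n f) ≤ C * luxNorm A f

/-- `L^{A_m}` is the optimal (smallest) Orlicz target for `L^A`. -/
def IsOptimalOrliczTarget (m n : ℕ) (A B : ℝ → ℝ≥0∞) : Prop :=
  (∃ C : ℝ≥0∞, 0 < C ∧ C < ∞ ∧
      ∀ f : ℝ → ℝ≥0∞, Measurable f → luxNorm B (hardyOp m n f) ≤ C * luxNorm A f) ∧
  ∀ B' : ℝ → ℝ≥0∞, IsYoung B' →
    (∃ C : ℝ≥0∞, 0 < C ∧ C < ∞ ∧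
       ∀ f : ℝ → ℝ≥0∞, Measurable f → luxNorm B' (hardyOp m n f) ≤ C * luxNorm A f) →
    ∃ c : ℝ≥0∞, 0 < c ∧ c < ∞ ∧
      ∀ g : ℝ → ℝ≥0∞, Measurable g → luxNorm B' g ≤ c * luxNorm B g

/-- Model Young-function behaviour `t^p (1 - log t)^a` (near zero). -/
def modelZero (p a : ℝ) (t : ℝ) : ℝ≥0∞ := ENNReal.ofReal (t ^ p * (1 - Real.log t) ^ a)

/-- Model Young-function behaviour `t^p (1 + log t)^a` (near infinity). -/
def modelInf (p a : ℝ) (t : ℝ) : ℝ≥0∞ := ENNReal.ofReal (t ^ p * (1 + Real.log t) ^ a)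



lemma st_lipschitz : ∃ K : ℝ≥0, LipschitzWith K Real.smoothTransition := by
  have hc : ContDiff ℝ 1 Real.smoothTransition := Real.smoothTransition.contDiff (n := 1)
  have hd : Continuous (deriv Real.smoothTransition) := hc.continuous_deriv le_rfl
  obtain ⟨M, hM⟩ := (isCompact_Icc (a := (0:ℝ)) (b := 1)).exists_bound_of_continuousOn hd.continuousOn
  refine ⟨M.toNNReal, lipschitzWith_of_nnnorm_deriv_le (hc.differentiable one_ne_zero) fun x => ?_⟩
  rw [← NNReal.coe_le_coe, coe_nnnorm]
  refine le_trans ?_ (Real.le_coe_toNNReal M)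
  by_cases hx : x ∈ Icc (0:ℝ) 1
  · exact hM x hx
  · have h0 : deriv Real.smoothTransition x = 0 := by
      rw [mem_Icc, not_and_or, not_le, not_le] at hx
      rcases hx with hx | hx
      · apply IsLocalMin.deriv_eq_zero
        apply Eventually.of_forall
        intro y
        rw [Real.smoothTransition.zero_of_nonpos hx.le]
        exact Real.smoothTransition.nonneg y
      · apply IsLocalMax.deriv_eq_zero
        apply Eventually.of_forall
        intro y
        rw [Real.smoothTransition.one_of_one_le hx.le]
        exact Real.smoothTransition.le_one y
    rw [h0]
    simpa using (norm_nonneg _).trans (hM 0 (by simp))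

def trunc {H : Type*} [NormedAddCommGroup H] (a b : ℝ) (y : H) : ℝ :=
  Real.smoothTransition ((‖y‖ - a) / (b - a))

section
variable {H : Type*} [NormedAddCommGroup H] {a b : ℝ}

lemma trunc_nonneg (y : H) : 0 ≤ trunc a b y := Real.smoothTransition.nonneg _
lemma trunc_le_one (y : H) : trunc a b y ≤ 1 := Real.smoothTransition.le_one _
lemma trunc_zero (hab : a < b) {y : H} (h : ‖y‖ ≤ a) : trunc a b y = 0 :=
  Real.smoothTransition.zero_of_nonpos (div_nonpos_of_nonpos_of_nonneg (by linarith) (by linarith))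
lemma trunc_one (hab : a < b) {y : H} (h : b ≤ ‖y‖) : trunc a b y = 1 :=
  Real.smoothTransition.one_of_one_le (by rw [le_div_iff₀ (by linarith)]; linarith)

lemma trunc_lip {K : ℝ≥0} (hK : LipschitzWith K Real.smoothTransition) (hab : a < b) :
    LipschitzWith (K / (b - a).toNNReal) (trunc a b : H → ℝ) := by
  apply LipschitzWith.of_dist_le_mul
  intro x y
  refine (hK.dist_le_mul _ _).trans ?_
  have h0 : 0 < b - a := by linarith
  rw [Real.dist_eq, NNReal.coe_div, Real.coe_toNNReal _ h0.le, ← sub_div, abs_div, abs_of_pos h0,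
    div_mul_eq_mul_div, mul_div_assoc]
  gcongr
  rw [sub_sub_sub_cancel_right, dist_eq_norm]
  exact abs_norm_sub_norm_le x y

lemma trunc_contDiff [InnerProductSpace ℝ H] (ha : 0 < a) (hab : a < b) :
    ContDiff ℝ 1 (trunc a b : H → ℝ) := by
  rw [contDiff_iff_contDiffAt]
  intro y
  by_cases hy : y = 0
  · subst hy
    have : (trunc a b : H → ℝ) =ᶠ[𝓝 0] fun _ => 0 := by
      filter_upwards [Metric.ball_mem_nhds (0:H) ha] with z hz
      exact trunc_zero hab (by simpa using (mem_ball_zero_iff.1 hz).le)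
    exact contDiffAt_const.congr_of_eventuallyEq this
  · have h1 : ContDiffAt ℝ 1 (fun y : H => (‖y‖ - a) / (b - a)) y :=
      ((contDiffAt_norm ℝ hy).sub contDiffAt_const).div_const _
    exact (Real.smoothTransition.contDiffAt (n := 1)).comp y h1
end

lemma isop (n : ℕ) (hn : 2 ≤ n) : ∃ C : ℝ≥0, ∀ (d : ℕ)
    (v : EuclideanSpace ℝ (Fin n) → EuclideanSpace ℝ (Fin d)), ContDiff ℝ 1 v →
    ∀ a b : ℝ, 0 < a → a < b → volume {x | a < ‖v x‖} < ∞ →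
    ENNReal.ofReal (b - a) * volume {x | b ≤ ‖v x‖} ^ (1 - 1 / (n:ℝ)) ≤
      C * ∫⁻ x in {x | a < ‖v x‖ ∧ ‖v x‖ < b}, ‖fderiv ℝ v x‖ₑ := by
  obtain ⟨K, hK⟩ := st_lipschitz
  set p : ℝ≥0 := NNReal.conjExponent n with hp
  have hn1 : (1:ℝ≥0) < n := by exact_mod_cast (by omega : 1 < n)
  have hpc : NNReal.HolderConjugate n p := NNReal.HolderConjugate.conjExponent hn1
  have hpinv : 1 - 1 / (n:ℝ) = (p:ℝ)⁻¹ := by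
    have := hpc.coe.one_sub_inv
    simpa using this
  have hppos : 0 < (p:ℝ) := hpc.coe.symm.pos
  set C0 : ℝ≥0 := eLpNormLESNormFDerivOneConst (volume : Measure (EuclideanSpace ℝ (Fin n))) p
  refine ⟨C0 * K, fun d v hv a b ha hab hfin => ?_⟩
  rw [hpinv]
  set w : EuclideanSpace ℝ (Fin n) → ℝ := fun x => trunc a b (v x) with hw
  have hwc : ContDiff ℝ 1 w := (trunc_contDiff ha hab).comp hv
  have hvd : Differentiable ℝ v := hv.differentiable one_ne_zero
  have hwd : Differentiable ℝ w := hwc.differentiable one_ne_zero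
  have hba : 0 < b - a := by linarith
  have hwf : ∀ x, ‖fderiv ℝ w x‖ₑ ≤
      {x | a < ‖v x‖ ∧ ‖v x‖ < b}.indicator
        (fun x => ((K / (b - a).toNNReal : ℝ≥0) : ℝ≥0∞) * ‖fderiv ℝ v x‖ₑ) x := by
    intro x
    by_cases hx : a < ‖v x‖ ∧ ‖v x‖ < b
    · rw [indicator_of_mem (by exact hx)]
      have h1 : fderiv ℝ w x = (fderiv ℝ (trunc a b) (v x)).comp (fderiv ℝ v x) :=
        fderiv_comp x (((trunc_contDiff ha hab).differentiable one_ne_zero) _) (hvd x)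
      rw [h1]
      have h2 : ‖fderiv ℝ (trunc a b) (v x)‖ ≤ (K / (b - a).toNNReal : ℝ≥0) :=
        norm_fderiv_le_of_lipschitz ℝ (trunc_lip hK hab)
      have h3 : ‖(fderiv ℝ (trunc a b) (v x)).comp (fderiv ℝ v x)‖₊ ≤
          (K / (b - a).toNNReal : ℝ≥0) * ‖fderiv ℝ v x‖₊ := by
        refine (ContinuousLinearMap.opNNNorm_comp_le _ _).trans ?_
        gcongr
        exact_mod_cast h2
      simp only [enorm_eq_nnnorm]
      exact_mod_cast h3
    · have : fderiv ℝ w x = 0 := by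
        rw [not_and_or, not_lt, not_lt] at hx
        rcases hx with hx | hx
        · apply IsLocalMin.fderiv_eq_zero
          apply Eventually.of_forall
          intro y
          simp only [hw]
          rw [trunc_zero hab hx]
          exact trunc_nonneg _
        · apply IsLocalMax.fderiv_eq_zero
          apply Eventually.of_forall
          intro y
          simp only [hw]
          rw [trunc_one hab hx]
          exact trunc_le_one _
      rw [this, enorm_eq_nnnorm, nnnorm_zero]
      simp
  have hmeas : MeasurableSet {x | a < ‖v x‖ ∧ ‖v x‖ < b} :=
    (measurableSet_lt measurable_const hv.continuous.norm.measurable).inter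
      (measurableSet_lt hv.continuous.norm.measurable measurable_const)
  have hmeasa : MeasurableSet {x | a < ‖v x‖} :=
    (measurableSet_lt measurable_const hv.continuous.norm.measurable)
  set I := ∫⁻ x in {x | a < ‖v x‖ ∧ ‖v x‖ < b}, ‖fderiv ℝ v x‖ₑ with hI
  have hwI : ∫⁻ x, ‖fderiv ℝ w x‖ₑ ≤ ((K / (b - a).toNNReal : ℝ≥0) : ℝ≥0∞) * I := by
    refine (lintegral_mono hwf).trans ?_
    rw [lintegral_indicator hmeas, lintegral_const_mul' _ _ ENNReal.coe_ne_top]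
  set M := volume {x | a < ‖v x‖} with hM
  -- estimate on balls
  have hball : ∀ R : ℝ, 0 < R →
      volume ({x | b ≤ ‖v x‖} ∩ Metric.closedBall 0 R) ^ (p:ℝ)⁻¹ ≤
        C0 * (((K / (b - a).toNNReal : ℝ≥0) : ℝ≥0∞) * I + ((K / R.toNNReal : ℝ≥0) : ℝ≥0∞) * M) := by
    intro R hR
    have hR2 : R < 2 * R := by linarith
    set η : EuclideanSpace ℝ (Fin n) → ℝ := fun x => 1 - trunc R (2 * R) x with hη
    have hηc : ContDiff ℝ 1 η := contDiff_const.sub (trunc_contDiff hR hR2)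
    have hηd : Differentiable ℝ η := hηc.differentiable one_ne_zero
    have hη0 : ∀ x, 0 ≤ η x := fun x => by simp only [hη]; linarith [trunc_le_one (a := R) (b := 2*R) x]
    have hη1 : ∀ x, η x ≤ 1 := fun x => by simp only [hη]; linarith [trunc_nonneg (a := R) (b := 2*R) x]
    have hηf : ∀ x, ‖fderiv ℝ η x‖ ≤ (K / R.toNNReal : ℝ≥0) := by
      intro x
      have : fderiv ℝ η x = - fderiv ℝ (trunc R (2*R)) x := by
        simp only [hη]
        rw [fderiv_const_sub]
      rw [this, norm_neg]
      have h := norm_fderiv_le_of_lipschitz ℝ (x₀ := x) (trunc_lip (H := EuclideanSpace ℝ (Fin n)) hK hR2)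
      rwa [show 2 * R - R = R by ring] at h
    set g : EuclideanSpace ℝ (Fin n) → ℝ := fun x => w x * η x with hg
    have hgc : ContDiff ℝ 1 g := hwc.mul hηc
    have hgs : HasCompactSupport g := by
      apply HasCompactSupport.intro (isCompact_closedBall 0 (2*R))
      intro x hx
      simp only [Metric.mem_closedBall, dist_zero_right, not_le] at hx
      simp [hg, hη, trunc_one hR2 hx.le]
    have hpc' : NNReal.HolderConjugate
        (Module.finrank ℝ (EuclideanSpace ℝ (Fin n)) : ℝ≥0) p := by simpa using hpc
    have key := eLpNorm_le_eLpNorm_fderiv_one volume hgc hgs hpc'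
    have hp0 : (p : ℝ≥0∞) ≠ 0 := by
      have : p ≠ 0 := by intro h; simp [h] at hppos
      exact_mod_cast this
    have hch := mul_meas_ge_le_pow_eLpNorm' volume hp0 ENNReal.coe_ne_top
      hgc.continuous.aestronglyMeasurable 1
    rw [ENNReal.one_rpow, one_mul] at hch
    calc volume ({x | b ≤ ‖v x‖} ∩ Metric.closedBall 0 R) ^ (p:ℝ)⁻¹
        ≤ volume {x | 1 ≤ ‖g x‖ₑ} ^ (p:ℝ)⁻¹ := by
          gcongr
          rintro x ⟨hx1, hx2⟩
          have : g x = 1 := by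
            simp only [hg, hη, hw]
            rw [trunc_one hab hx1, trunc_zero hR2 (by simpa using hx2)]
            norm_num
          simp [this]
      _ ≤ (eLpNorm g p volume ^ (p:ℝ)) ^ (p:ℝ)⁻¹ := by
          gcongr
          simpa using hch
      _ = eLpNorm g p volume := by
          rw [← ENNReal.rpow_mul, mul_inv_cancel₀ hppos.ne', ENNReal.rpow_one]
      _ ≤ C0 * eLpNorm (fderiv ℝ g) 1 volume := key
      _ ≤ _ := by
          gcongr
          rw [eLpNorm_one_eq_lintegral_enorm]
          calc ∫⁻ x, ‖fderiv ℝ g x‖ₑ ≤ ∫⁻ x, (‖fderiv ℝ w x‖ₑ +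
                {x | a < ‖v x‖}.indicator (fun _ => ((K / R.toNNReal : ℝ≥0) : ℝ≥0∞)) x) := by
                apply lintegral_mono
                intro x
                have h1 : fderiv ℝ g x = w x • fderiv ℝ η x + η x • fderiv ℝ w x :=
                  fderiv_mul (hwd x) (hηd x)
                simp only
                rw [h1, add_comm]
                refine (show ‖η x • fderiv ℝ w x + w x • fderiv ℝ η x‖ₑ ≤
                    ‖η x • fderiv ℝ w x‖ₑ + ‖w x • fderiv ℝ η x‖ₑ by
                  simp only [enorm_eq_nnnorm]
                  exact_mod_cast nnnorm_add_le _ _).trans ?_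
                gcongr
                · rw [enorm_smul]
                  calc ‖η x‖ₑ * ‖fderiv ℝ w x‖ₑ ≤ 1 * ‖fderiv ℝ w x‖ₑ := by
                        gcongr
                        rw [Real.enorm_eq_ofReal (hη0 x)]
                        simpa using hη1 x
                    _ = _ := one_mul _
                · by_cases hx : a < ‖v x‖
                  · rw [indicator_of_mem (by exact hx), enorm_smul]
                    calc ‖w x‖ₑ * ‖fderiv ℝ η x‖ₑ ≤ 1 * ((K / R.toNNReal : ℝ≥0) : ℝ≥0∞) := by
                          gcongr
                          · rw [Real.enorm_eq_ofReal (trunc_nonneg _)]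
                            simpa using trunc_le_one _
                          · rw [enorm_eq_nnnorm]
                            exact_mod_cast hηf x
                      _ = _ := one_mul _
                  · have : w x = 0 := trunc_zero hab (not_lt.1 hx)
                    rw [this, zero_smul, enorm_eq_nnnorm, nnnorm_zero]
                    simp
            _ = (∫⁻ x, ‖fderiv ℝ w x‖ₑ) + ((K / R.toNNReal : ℝ≥0) : ℝ≥0∞) * M := by
                rw [lintegral_add_right _ (measurable_const.indicator hmeasa),
                  lintegral_indicator hmeasa, lintegral_const, Measure.restrict_apply_univ]
            _ ≤ _ := by gcongr
  have hlim : volume {x | b ≤ ‖v x‖} ^ (p:ℝ)⁻¹ ≤ C0 * (((K / (b - a).toNNReal : ℝ≥0) : ℝ≥0∞) * I) := by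
    have hU : {x | b ≤ ‖v x‖} = ⋃ N : ℕ, ({x | b ≤ ‖v x‖} ∩ Metric.closedBall 0 ((N:ℝ)+1)) := by
      rw [← inter_iUnion]
      symm
      rw [inter_eq_left]
      intro x _
      obtain ⟨N, hN⟩ := exists_nat_ge ‖x‖
      exact mem_iUnion.2 ⟨N, by simp; linarith⟩
    have hmono : Monotone fun N : ℕ => ({x | b ≤ ‖v x‖} ∩ Metric.closedBall 0 ((N:ℝ)+1)) := by
      intro N N' h
      apply inter_subset_inter_right
      apply Metric.closedBall_subset_closedBall
      gcongr
    have t1 := (tendsto_measure_iUnion_atTop (μ := volume) hmono)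
    rw [← hU] at t1
    have t2 := (ENNReal.continuous_rpow_const (y := (p:ℝ)⁻¹)).continuousAt.tendsto.comp t1
    have t3 : Tendsto (fun N : ℕ => ((K / ((N:ℝ)+1).toNNReal : ℝ≥0) : ℝ≥0∞)) atTop (𝓝 0) := by
      rw [← ENNReal.coe_zero, ENNReal.tendsto_coe]
      rw [← NNReal.tendsto_coe]
      have : Tendsto (fun N : ℕ => (K:ℝ) / ((N:ℝ) + 1)) atTop (𝓝 0) :=
        tendsto_const_nhds.div_atTop (tendsto_natCast_atTop_atTop.atTop_add tendsto_const_nhds)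
      refine this.congr fun N => ?_
      rw [NNReal.coe_div, Real.coe_toNNReal _ (by positivity)]
    have t4 := ENNReal.Tendsto.mul_const (b := M) t3 (Or.inr hfin.ne)
    have t5 := ENNReal.Tendsto.const_mul (a := (C0:ℝ≥0∞)) ((tendsto_const_nhds (x := ((K / (b - a).toNNReal : ℝ≥0) : ℝ≥0∞) * I)).add t4) (Or.inr ENNReal.coe_ne_top)
    rw [zero_mul, add_zero] at t5
    exact le_of_tendsto_of_tendsto' t2 t5 fun N => hball _ (by positivity)
  calc ENNReal.ofReal (b - a) * volume {x | b ≤ ‖v x‖} ^ (p:ℝ)⁻¹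
      ≤ ENNReal.ofReal (b - a) * (C0 * (((K / (b - a).toNNReal : ℝ≥0) : ℝ≥0∞) * I)) := by gcongr
    _ = ((C0 * K : ℝ≥0) : ℝ≥0∞) * I := by
      rw [ENNReal.ofReal, ← mul_assoc, ← mul_assoc, ← ENNReal.coe_mul, ← ENNReal.coe_mul]
      congr 2
      have : (b - a).toNNReal ≠ 0 := by simpa using hab
      field_simp

def rearr2 {α : Type*} [MeasurableSpace α] (μ : Measure α) (f : α → ℝ≥0∞) (k : ℤ) : ℝ≥0∞ :=
  rearrangement μ f ((2:ℝ) ^ (k:ℝ))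

/-- the power `2^x` as an extended nonnegative real -/
def E2 (x : ℝ) : ℝ≥0∞ := ENNReal.ofReal ((2:ℝ) ^ x)

lemma E2_add (x y : ℝ) : E2 (x + y) = E2 x * E2 y := by
  rw [E2, E2, E2, Real.rpow_add two_pos, ENNReal.ofReal_mul (by positivity)]
lemma E2_zero : E2 0 = 1 := by simp [E2]
lemma E2_one : E2 1 = 2 := by simp [E2]
lemma E2_ne_top (x : ℝ) : E2 x ≠ ∞ := ENNReal.ofReal_ne_top
lemma E2_ne_zero (x : ℝ) : E2 x ≠ 0 := by
  rw [E2, Ne, ENNReal.ofReal_eq_zero, not_le]; positivity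
lemma E2_neg_mul (x : ℝ) : E2 (-x) * E2 x = 1 := by rw [← E2_add]; simp [E2_zero]
lemma E2_natmul (i : ℕ) (x : ℝ) : E2 (i * x) = E2 x ^ i := by
  rw [E2, E2, ← ENNReal.ofReal_pow (by positivity), ← Real.rpow_mul_natCast two_pos.le, mul_comm]
lemma E2_rpow (x y : ℝ) : E2 x ^ y = E2 (x * y) := by
  rw [E2, E2, ENNReal.ofReal_rpow_of_pos (by positivity), ← Real.rpow_mul two_pos.le]
lemma E2_mono {x y : ℝ} (h : x ≤ y) : E2 x ≤ E2 y :=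
  ENNReal.ofReal_le_ofReal (Real.rpow_le_rpow_of_exponent_le one_le_two h)

lemma geom_fin {τ : ℝ} (h : 0 < τ) : ∑' i : ℕ, E2 (-(i * τ)) ≠ ∞ := by
  have h1 : ∀ i : ℕ, E2 (-(i * τ)) = E2 (-τ) ^ i := fun i => by rw [← E2_natmul]; ring_nf
  simp_rw [h1]
  rw [ENNReal.tsum_geometric, ENNReal.inv_ne_top, Ne, tsub_eq_zero_iff_le, not_le, E2,
    ENNReal.ofReal_lt_one]
  exact Real.rpow_lt_one_of_one_lt_of_neg one_lt_two (by linarith)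

section
variable {α : Type*} [MeasurableSpace α] {μ : Measure α}

lemma lt_rearr {f : α → ℝ≥0∞} {t : ℝ} {l : ℝ≥0∞} (h : l < rearrangement μ f t) :
    ENNReal.ofReal t < μ {x | l < f x} := by
  by_contra hc
  exact absurd (sInf_le (show l ∈ {l : ℝ≥0∞ | μ {x | l < f x} ≤ ENNReal.ofReal t} from not_lt.1 hc))
    (not_le.2 h)

lemma meas_rearr (f : α → ℝ≥0∞) (t : ℝ) :
    μ {x | rearrangement μ f t < f x} ≤ ENNReal.ofReal t := by
  obtain ⟨u, hu, hl, hS⟩ := exists_seq_tendsto_sInf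
    (S := {l : ℝ≥0∞ | μ {x | l < f x} ≤ ENNReal.ofReal t}) ⟨∞, by simp⟩ (OrderBot.bddBelow _)
  have hsub : {x | rearrangement μ f t < f x} ⊆ ⋃ N, {x | u N < f x} := by
    intro x hx
    obtain ⟨N, hN⟩ := (hl.eventually_lt_const hx).exists
    exact mem_iUnion.2 ⟨N, hN⟩
  refine (measure_mono hsub).trans ?_
  rw [Monotone.measure_iUnion]
  · exact iSup_le hS
  · intro N N' h x hx
    exact (hu h).trans_lt hx

lemma rearr_anti (f : α → ℝ≥0∞) : Antitone (rearrangement μ f) := by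
  intro s t h
  exact sInf_le_sInf fun l hl => le_trans hl (ENNReal.ofReal_le_ofReal h)

lemma rearr_le {f g : α → ℝ≥0∞} (c : ℝ≥0) (h : ∀ x, f x ≤ c * g x) (t : ℝ) :
    rearrangement μ f t ≤ c * rearrangement μ g t := by
  apply sInf_le
  refine le_trans (measure_mono ?_) (meas_rearr g t)
  intro x hx
  by_contra hc
  exact absurd (hx.trans_le (h x)) (not_lt.2 (by gcongr; exact not_lt.1 hc))

lemma rearr2_anti (f : α → ℝ≥0∞) : Antitone (rearr2 μ f) := by
  intro s t h
  apply rearr_anti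
  exact Real.rpow_le_rpow_of_exponent_le one_le_two (by exact_mod_cast h)

lemma meas_rearr2 (f : α → ℝ≥0∞) (k : ℤ) : μ {x | rearr2 μ f k < f x} ≤ E2 k := meas_rearr f _

lemma rearr2_le {f : α → ℝ≥0∞} {k : ℤ} {l : ℝ≥0∞} (h : μ {x | l < f x} ≤ E2 k) :
    rearr2 μ f k ≤ l := sInf_le h

lemma E2_small {ε : ℝ≥0∞} (hε : ε ≠ 0) (k : ℤ) : ∃ i : ℕ, E2 ((k - i : ℤ) : ℝ) < ε := by
  have h2 : (2⁻¹ : ℝ≥0∞) < 1 := by simp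
  have : Tendsto (fun i : ℕ => E2 k * (2⁻¹ : ℝ≥0∞) ^ i) atTop (𝓝 (E2 k * 0)) :=
    ENNReal.Tendsto.const_mul (ENNReal.tendsto_pow_atTop_nhds_zero_of_lt_one h2) (Or.inr (E2_ne_top _))
  rw [mul_zero] at this
  obtain ⟨i, hi⟩ := (this.eventually_lt_const (pos_iff_ne_zero.2 hε)).exists
  refine ⟨i, ?_⟩
  convert hi using 1
  have : (2⁻¹ : ℝ≥0∞) = E2 (-1) := by
    rw [E2, Real.rpow_neg_one, ENNReal.ofReal_inv_of_pos two_pos]; simp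
  rw [this, ← E2_natmul, ← E2_add]
  push_cast
  ring_nf

lemma hardy_aux {g : α → ℝ≥0∞} (hg : Measurable g) {A : Set α} (k : ℤ)
    (hA : μ A ≤ E2 (k + 1)) :
    ∫⁻ x in A, g x ∂μ ≤ 2 * ∑' i : ℕ, E2 ((k - i : ℤ):ℝ) * rearr2 μ g (k - i) := by
  set G := rearr2 μ g with hG
  have hnull : μ {x | ∀ i : ℕ, G (k - i) < g x} = 0 := by
    by_contra hne
    obtain ⟨i, hi⟩ := E2_small hne k
    have hsub : {x | ∀ i : ℕ, G (k - i) < g x} ⊆ {x | G (k - i) < g x} := fun x hx => hx i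
    exact absurd ((measure_mono hsub).trans (meas_rearr2 g (k - i))) (not_le.2 hi)
  have hae : ∀ᵐ x ∂μ, g x ≤ G k + ∑' i : ℕ,
      {x | G (k - i) < g x}.indicator (fun _ => G (k - (i + 1 : ℕ))) x := by
    have : ∀ᵐ x ∂μ, ¬ ∀ i : ℕ, G (k - i) < g x := by
      rw [ae_iff]; simpa only [not_not] using hnull
    filter_upwards [this] with x hx
    push Not at hx
    classical
    rcases h : Nat.find hx with _ | j
    · have := Nat.find_spec hx
      rw [h] at this
      exact le_add_right (by simpa using this)
    · have h1 := Nat.find_spec hx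
      rw [h] at h1
      have h2 : G (k - j) < g x := not_le.1 (Nat.find_min hx (by omega))
      refine le_add_left (le_trans ?_ (ENNReal.le_tsum j))
      rw [indicator_of_mem (by exact h2)]
      exact h1
  have hm : ∀ i : ℕ, MeasurableSet {x | G (k - i) < g x} := fun i => measurableSet_lt measurable_const hg
  calc ∫⁻ x in A, g x ∂μ ≤ ∫⁻ x in A, (G k + ∑' i : ℕ,
      {x | G (k - i) < g x}.indicator (fun _ => G (k - (i + 1 : ℕ))) x) ∂μ :=
        lintegral_mono_ae (ae_restrict_of_ae hae)
    _ = G k * μ A + ∑' i : ℕ, G (k - (i + 1 : ℕ)) * μ.restrict A {x | G (k - i) < g x} := by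
        rw [lintegral_add_left measurable_const, lintegral_const, Measure.restrict_apply_univ,
          lintegral_tsum (fun i => (measurable_const.indicator (hm i)).aemeasurable)]
        congr 2
        ext i
        rw [lintegral_indicator (hm i), lintegral_const, Measure.restrict_apply_univ]
    _ ≤ G k * (2 * E2 k) + ∑' i : ℕ, 2 * (E2 ((k - (i + 1 : ℕ) : ℤ) : ℝ) * G (k - (i + 1 : ℕ))) := by
        refine add_le_add ?_ (ENNReal.tsum_le_tsum fun i => ?_)
        · gcongr
          rw [← E2_one, ← E2_add, add_comm]; exact hA
        · calc G (k - (i + 1 : ℕ)) * μ.restrict A {x | G (k - i) < g x}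
              ≤ G (k - (i + 1 : ℕ)) * E2 ((k - i : ℤ) : ℝ) := by
                gcongr
                exact (Measure.restrict_apply_le _ _).trans (meas_rearr2 g _)
            _ = 2 * (E2 ((k - (i + 1 : ℕ) : ℤ) : ℝ) * G (k - (i + 1 : ℕ))) := by
                rw [← mul_assoc, ← E2_one, ← E2_add, mul_comm]
                congr 2
                push_cast
                ring
    _ = _ := by
        rw [tsum_eq_zero_add' (f := fun i : ℕ => E2 ((k - i : ℤ):ℝ) * rearr2 μ g (k - i))
          ENNReal.summable, ENNReal.tsum_mul_left, mul_add]
        congr 1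
        simp [hG]
        ring
end

/-- discrete `ℓ^q` norm over `ℤ` -/
def dn (q : ℝ≥0∞) (x : ℤ → ℝ≥0∞) : ℝ≥0∞ :=
  if q = ∞ then ⨆ k, x k else (∑' k, x k ^ q.toReal) ^ (1 / q.toReal)

lemma dn_mono (q : ℝ≥0∞) {x y : ℤ → ℝ≥0∞} (h : ∀ k, x k ≤ y k) : dn q x ≤ dn q y := by
  unfold dn
  split_ifs
  · exact iSup_mono h
  · gcongr with k
    exact h k

lemma tsum_jensen {ι : Type*} {r : ℝ} (hr : 1 ≤ r) (w f : ι → ℝ≥0∞) :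
    (∑' i, w i * f i) ^ r ≤ (∑' i, w i) ^ (r - 1) * ∑' i, w i * f i ^ r := by
  have hr0 : 0 < r := by linarith
  have h : ∑' i, w i * f i ≤ (∑' i, w i) ^ (1 - r⁻¹) * (∑' i, w i * f i ^ r) ^ r⁻¹ := by
    rw [ENNReal.tsum_eq_iSup_sum]
    refine iSup_le fun s => (ENNReal.inner_le_weight_mul_Lp_of_nonneg s hr w f).trans ?_
    have : 0 ≤ 1 - r⁻¹ := sub_nonneg.2 (inv_le_one_of_one_le₀ hr)
    gcongr
    · exact ENNReal.sum_le_tsum s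
    · exact ENNReal.sum_le_tsum s
  calc _ ≤ ((∑' i, w i) ^ (1 - r⁻¹) * (∑' i, w i * f i ^ r) ^ r⁻¹) ^ r := by gcongr
    _ = _ := by
      rw [ENNReal.mul_rpow_of_nonneg _ _ hr0.le, ← ENNReal.rpow_mul, ← ENNReal.rpow_mul,
        inv_mul_cancel₀ hr0.ne', ENNReal.rpow_one]
      congr 2
      field_simp

lemma dn_young {ι : Type*} {q : ℝ≥0∞} (hq : 1 ≤ q) {x y : ℤ → ℝ≥0∞} (w : ι → ℝ≥0∞) (s : ι → ℤ)
    (h : ∀ k, x k ≤ ∑' i, w i * y (k + s i)) : dn q x ≤ (∑' i, w i) * dn q y := by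
  refine (dn_mono q h).trans ?_
  unfold dn
  split_ifs with hqt
  · refine iSup_le fun k => ?_
    rw [← ENNReal.tsum_mul_right]
    refine ENNReal.tsum_le_tsum fun i => ?_
    gcongr
    exact le_iSup y _
  · set r := q.toReal with hr
    have hr1 : 1 ≤ r := by
      rw [hr, ← ENNReal.toReal_one]
      exact ENNReal.toReal_mono hqt hq
    have hr0 : 0 < r := by linarith
    have key : ∑' k, (∑' i, w i * y (k + s i)) ^ r ≤ (∑' i, w i) ^ r * ∑' k, y k ^ r := by
      calc _ ≤ ∑' k, (∑' i, w i) ^ (r - 1) * ∑' i, w i * y (k + s i) ^ r :=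
            ENNReal.tsum_le_tsum fun k => tsum_jensen hr1 _ _
        _ = (∑' i, w i) ^ (r - 1) * ∑' i, w i * ∑' k, y k ^ r := by
            rw [ENNReal.tsum_mul_left, ENNReal.tsum_comm]
            congr 2
            ext i
            rw [ENNReal.tsum_mul_left]
            congr 1
            exact (Equiv.addRight (s i)).tsum_eq (fun k => y k ^ r)
        _ = _ := by
            rw [ENNReal.tsum_mul_right, ← mul_assoc]
            congr 1
            have := ENNReal.rpow_add_of_nonneg (x := ∑' i, w i) (r - 1) 1 (by linarith) one_pos.le
            rw [ENNReal.rpow_one] at this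
            rw [← this]
            congr 1
            ring
    calc _ ≤ ((∑' i, w i) ^ r * ∑' k, y k ^ r) ^ (1 / r) := by gcongr
      _ = _ := by
        rw [ENNReal.mul_rpow_of_nonneg _ _ (by positivity), ← ENNReal.rpow_mul,
          mul_one_div_cancel hr0.ne', ENNReal.rpow_one]

lemma dyadic_cover : (⋃ k : ℤ, Ioc ((2:ℝ) ^ (k:ℝ)) ((2:ℝ) ^ ((k:ℝ) + 1))) = Ioi 0 := by
  ext t
  simp only [mem_iUnion, mem_Ioc, mem_Ioi]
  constructor
  · rintro ⟨k, h, _⟩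
    exact lt_trans (by positivity) h
  · intro ht
    obtain ⟨k, hk⟩ := exists_mem_Ioc_zpow ht one_lt_two
    refine ⟨k, ?_⟩
    have h1 : (2:ℝ) ^ (k:ℝ) = 2 ^ k := Real.rpow_intCast _ _
    have h2 : (2:ℝ) ^ ((k:ℝ) + 1) = 2 ^ (k + 1) := by
      rw [← Real.rpow_intCast]; push_cast; rfl
    rw [h1, h2]
    exact hk

lemma dyadic_disj : Pairwise (Function.onFun Disjoint
    fun k : ℤ => Ioc ((2:ℝ) ^ (k:ℝ)) ((2:ℝ) ^ ((k:ℝ) + 1))) := by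
  have hm : Monotone fun k : ℤ => (2:ℝ) ^ (k:ℝ) := fun i j h =>
    Real.rpow_le_rpow_of_exponent_le one_le_two (by exact_mod_cast h)
  have := hm.pairwise_disjoint_on_Ioc_succ
  simpa using this

lemma dyadic_vol (k : ℤ) : volume (Ioc ((2:ℝ) ^ (k:ℝ)) ((2:ℝ) ^ ((k:ℝ) + 1))) = E2 k := by
  rw [Real.volume_Ioc, E2, Real.rpow_add two_pos, Real.rpow_one]
  ring_nf

lemma wt_upper {γ t : ℝ} {k : ℤ} (ht : t ∈ Ioc ((2:ℝ) ^ (k:ℝ)) ((2:ℝ) ^ ((k:ℝ) + 1))) :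
    ENNReal.ofReal (t ^ γ) ≤ E2 |γ| * E2 (k * γ) := by
  have h0 : (0:ℝ) < 2 ^ (k:ℝ) := by positivity
  have ht0 : 0 < t := h0.trans ht.1
  rw [← E2_add]
  apply ENNReal.ofReal_le_ofReal
  rcases le_total 0 γ with h | h
  · calc t ^ γ ≤ ((2:ℝ) ^ ((k:ℝ) + 1)) ^ γ := Real.rpow_le_rpow ht0.le ht.2 h
      _ = _ := by rw [← Real.rpow_mul two_pos.le, abs_of_nonneg h]; ring_nf
  · calc t ^ γ ≤ ((2:ℝ) ^ (k:ℝ)) ^ γ := Real.rpow_le_rpow_of_nonpos h0 ht.1.le h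
      _ = 2 ^ (k * γ) := by rw [← Real.rpow_mul two_pos.le]
      _ ≤ _ := Real.rpow_le_rpow_of_exponent_le one_le_two (by linarith [abs_nonneg γ])

lemma wt_lower {γ t : ℝ} {k : ℤ} (ht : t ∈ Ioc ((2:ℝ) ^ (k:ℝ)) ((2:ℝ) ^ ((k:ℝ) + 1))) :
    E2 (k * γ) ≤ E2 |γ| * ENNReal.ofReal (t ^ γ) := by
  have h0 : (0:ℝ) < 2 ^ (k:ℝ) := by positivity
  have ht0 : 0 < t := h0.trans ht.1
  have h := wt_upper (γ := -γ) ht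
  rw [abs_neg] at h
  calc E2 (k * γ) = E2 (k * γ) * (ENNReal.ofReal (t ^ (-γ)) * ENNReal.ofReal (t ^ γ)) := by
        rw [← ENNReal.ofReal_mul (by positivity), ← Real.rpow_add ht0]; simp
    _ ≤ E2 (k * γ) * (E2 |γ| * E2 (k * -γ) * ENNReal.ofReal (t ^ γ)) := by gcongr
    _ = (E2 (-(k * γ)) * E2 (k * γ)) * (E2 |γ| * ENNReal.ofReal (t ^ γ)) := by
        rw [mul_neg]; ring
    _ = _ := by rw [E2_neg_mul, one_mul]

lemma dn_const {q : ℝ≥0∞} (hq : 1 ≤ q) {x y : ℤ → ℝ≥0∞} (c : ℝ≥0∞) (s : ℤ)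
    (h : ∀ k, x k ≤ c * y (k + s)) : dn q x ≤ c * dn q y := by
  have := dn_young hq (ι := Unit) (fun _ => c) (fun _ => s) (x := x) (y := y) (by simpa using h)
  simpa using this

lemma qinv_mul {q : ℝ≥0∞} (hq : 1 ≤ q) (hqt : q ≠ ∞) : q⁻¹.toReal * q.toReal = 1 := by
  rw [← ENNReal.toReal_mul, ENNReal.inv_mul_cancel (by positivity) hqt, ENNReal.toReal_one]

lemma cmp_upper (q : ℝ≥0∞) (hq : 1 ≤ q) (α : ℝ) : ∃ C : ℝ≥0, ∀ h : ℝ → ℝ≥0∞, Antitone h →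
    Lqnorm q (Ioi 0) (fun t => ENNReal.ofReal (t ^ (α - q⁻¹.toReal)) * h t) ≤
      C * dn q (fun k => E2 (k * α) * h ((2:ℝ) ^ (k:ℝ))) := by
  set γ := α - q⁻¹.toReal with hγ
  refine ⟨(E2 |γ|).toNNReal, fun h hh => ?_⟩
  rw [ENNReal.coe_toNNReal (E2_ne_top _)]
  have hpt : ∀ (k : ℤ), ∀ t ∈ Ioc ((2:ℝ) ^ (k:ℝ)) ((2:ℝ) ^ ((k:ℝ) + 1)),
      ENNReal.ofReal (t ^ γ) * h t ≤ E2 |γ| * E2 (k * γ) * h ((2:ℝ) ^ (k:ℝ)) := fun k t ht =>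
    mul_le_mul' (wt_upper ht) (hh ht.1.le)
  unfold Lqnorm dn
  split_ifs with hqt
  · have hγα : γ = α := by simp [hγ, hqt]
    refine essSup_le_of_ae_le _ ?_
    refine (ae_restrict_iff' measurableSet_Ioi).2 (Eventually.of_forall fun t ht => ?_)
    rw [← dyadic_cover] at ht
    obtain ⟨k, hk⟩ := mem_iUnion.1 ht
    refine (hpt k t hk).trans ?_
    rw [mul_assoc, hγα]
    refine mul_le_mul_right ?_ _
    exact le_iSup (fun k : ℤ => E2 (k * α) * h ((2:ℝ) ^ (k:ℝ))) k
  · set r := q.toReal with hr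
    have hqi := qinv_mul hq hqt
    have hr0 : 0 < r := ENNReal.toReal_pos (by positivity) hqt
    have key : ∫⁻ t in Ioi 0, (ENNReal.ofReal (t ^ γ) * h t) ^ r ≤
        E2 |γ| ^ r * ∑' k : ℤ, (E2 (k * α) * h ((2:ℝ) ^ (k:ℝ))) ^ r := by
      rw [← dyadic_cover, ← ENNReal.tsum_mul_left]
      refine (lintegral_iUnion_le _ _).trans (ENNReal.tsum_le_tsum fun k => ?_)
      calc _ ≤ ∫⁻ t in Ioc ((2:ℝ) ^ (k:ℝ)) ((2:ℝ) ^ ((k:ℝ) + 1)),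
            (E2 |γ| * E2 (k * γ) * h ((2:ℝ) ^ (k:ℝ))) ^ r := by
              refine setLIntegral_mono' measurableSet_Ioc fun t ht => ?_
              exact ENNReal.rpow_le_rpow (hpt k t ht) hr0.le
        _ = _ := by
          rw [setLIntegral_const, dyadic_vol, ENNReal.mul_rpow_of_nonneg _ _ hr0.le,
            ENNReal.mul_rpow_of_nonneg _ _ hr0.le, ENNReal.mul_rpow_of_nonneg _ _ hr0.le,
            E2_rpow (k * γ), E2_rpow (k * α)]
          have : (k * α * r : ℝ) = k * γ * r + k := by
            rw [hγ]; linear_combination (k:ℝ) * hqi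
          rw [this, E2_add]
          ring
    calc _ ≤ (E2 |γ| ^ r * ∑' k : ℤ, (E2 (k * α) * h ((2:ℝ) ^ (k:ℝ))) ^ r) ^ (1 / r) := by gcongr
      _ = _ := by
        rw [ENNReal.mul_rpow_of_nonneg _ _ (by positivity), ← ENNReal.rpow_mul,
          mul_one_div_cancel hr0.ne', ENNReal.rpow_one]

lemma cmp_lower (q : ℝ≥0∞) (hq : 1 ≤ q) (α : ℝ) : ∃ C : ℝ≥0, ∀ h : ℝ → ℝ≥0∞, Antitone h →
    dn q (fun k => E2 (k * α) * h ((2:ℝ) ^ (k:ℝ))) ≤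
    C * Lqnorm q (Ioi 0) (fun t => ENNReal.ofReal (t ^ (α - q⁻¹.toReal)) * h t) := by
  set γ := α - q⁻¹.toReal with hγ
  refine ⟨(E2 α * E2 |γ|).toNNReal, fun h hh => ?_⟩
  rw [ENNReal.coe_toNNReal (ENNReal.mul_ne_top (E2_ne_top _) (E2_ne_top _)), mul_assoc]
  have hshift : dn q (fun k => E2 (k * α) * h ((2:ℝ) ^ (k:ℝ))) ≤
      E2 α * dn q (fun k => E2 (k * α) * h ((2:ℝ) ^ ((k:ℝ) + 1))) := by
    refine dn_const hq _ (-1) fun k => ?_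
    rw [← mul_assoc, ← E2_add]
    push_cast
    ring_nf
    exact le_rfl
  refine hshift.trans ?_
  gcongr
  have hpt : ∀ (k : ℤ), ∀ t ∈ Ioc ((2:ℝ) ^ (k:ℝ)) ((2:ℝ) ^ ((k:ℝ) + 1)),
      E2 (k * γ) * h ((2:ℝ) ^ ((k:ℝ) + 1)) ≤ E2 |γ| * (ENNReal.ofReal (t ^ γ) * h t) :=
    fun k t ht => by
      rw [← mul_assoc]
      exact mul_le_mul' (wt_lower ht) (hh ht.2)
  unfold Lqnorm dn
  split_ifs with hqt
  · have hγα : γ = α := by simp [hγ, hqt]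
    refine iSup_le fun k => ?_
    have hae := ae_le_essSup (f := fun t => ENNReal.ofReal (t ^ γ) * h t)
      (μ := volume.restrict (Ioi 0))
    have hne : (volume.restrict (Ioi (0:ℝ))) (Ioc ((2:ℝ) ^ (k:ℝ)) ((2:ℝ) ^ ((k:ℝ) + 1))) ≠ 0 := by
      rw [Measure.restrict_apply measurableSet_Ioc, inter_eq_left.2, dyadic_vol]
      · exact E2_ne_zero _
      · rw [← dyadic_cover]
        exact subset_iUnion (fun k : ℤ => Ioc ((2:ℝ) ^ (k:ℝ)) ((2:ℝ) ^ ((k:ℝ) + 1))) k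
    obtain ⟨t, ht, ht'⟩ := (frequently_ae_mem_iff.2 hne).and_eventually hae |>.exists
    rw [← hγα]
    refine (hpt k t ht).trans ?_
    exact mul_le_mul_right ht' _
  · set r := q.toReal with hr
    have hqi := qinv_mul hq hqt
    have hr0 : 0 < r := ENNReal.toReal_pos (by positivity) hqt
    have key : ∑' k : ℤ, (E2 (k * α) * h ((2:ℝ) ^ ((k:ℝ) + 1))) ^ r ≤
        E2 |γ| ^ r * ∫⁻ t in Ioi 0, (ENNReal.ofReal (t ^ γ) * h t) ^ r := by
      rw [← dyadic_cover, lintegral_iUnion (fun _ => measurableSet_Ioc) dyadic_disj,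
        ← ENNReal.tsum_mul_left]
      refine (ENNReal.tsum_le_tsum fun k => ?_)
      calc _ = ∫⁻ t in Ioc ((2:ℝ) ^ (k:ℝ)) ((2:ℝ) ^ ((k:ℝ) + 1)),
            (E2 (k * γ) * h ((2:ℝ) ^ ((k:ℝ) + 1))) ^ r := by
              rw [setLIntegral_const, dyadic_vol, ENNReal.mul_rpow_of_nonneg _ _ hr0.le,
                ENNReal.mul_rpow_of_nonneg _ _ hr0.le,
                E2_rpow (k * γ), E2_rpow (k * α)]
              have : (k * α * r : ℝ) = k * γ * r + k := by
                rw [hγ]; linear_combination (k:ℝ) * hqi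
              rw [this, E2_add]
              ring
        _ ≤ ∫⁻ t in Ioc ((2:ℝ) ^ (k:ℝ)) ((2:ℝ) ^ ((k:ℝ) + 1)),
            E2 |γ| ^ r * (ENNReal.ofReal (t ^ γ) * h t) ^ r := by
              refine setLIntegral_mono' measurableSet_Ioc fun t ht => ?_
              rw [← ENNReal.mul_rpow_of_nonneg _ _ hr0.le]
              exact ENNReal.rpow_le_rpow (hpt k t ht) hr0.le
        _ = _ := by
          rw [lintegral_const_mul' _ _ (ENNReal.rpow_ne_top_of_nonneg hr0.le (E2_ne_top _))]
    calc _ ≤ (E2 |γ| ^ r * ∫⁻ t in Ioi 0, (ENNReal.ofReal (t ^ γ) * h t) ^ r) ^ (1 / r) := by gcongr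
      _ = _ := by
        rw [ENNReal.mul_rpow_of_nonneg _ _ (by positivity), ← ENNReal.rpow_mul,
          mul_one_div_cancel hr0.ne', ENNReal.rpow_one]


lemma disc (n : ℕ) (hn : 2 ≤ n) : ∃ C : ℝ≥0, ∀ (d : ℕ)
    (v : EuclideanSpace ℝ (Fin n) → EuclideanSpace ℝ (Fin d)), ContDiff ℝ 1 v →
    (∀ l : ℝ, 0 < l → volume {x | l < ‖v x‖} < ∞) → ∀ k : ℤ,
    rearr2 volume (fun x => ‖v x‖ₑ) k ≤ rearr2 volume (fun x => ‖v x‖ₑ) (k + 1) +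
      C * (E2 (-(k * (1 - 1 / (n:ℝ)))) *
        ∫⁻ x in {x | rearr2 volume (fun x => ‖v x‖ₑ) (k + 1) < ‖v x‖ₑ ∧
          ‖v x‖ₑ < rearr2 volume (fun x => ‖v x‖ₑ) k}, ‖fderiv ℝ v x‖ₑ) := by
  obtain ⟨C, hC⟩ := isop n hn
  refine ⟨C, fun d v hv hfin k => ?_⟩
  set β : ℝ := 1 - 1 / (n:ℝ) with hβ
  have hβ0 : 0 ≤ β := by
    have : 1 / (n:ℝ) ≤ 1 := by
      rw [div_le_one (by positivity)]; exact_mod_cast (by omega : 1 ≤ n)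
    linarith
  set f : EuclideanSpace ℝ (Fin n) → ℝ≥0∞ := fun x => ‖v x‖ₑ with hf
  set A := rearr2 volume f (k + 1) with hA
  set B := rearr2 volume f k with hB
  set J := ∫⁻ x in {x | A < ‖v x‖ₑ ∧ ‖v x‖ₑ < B}, ‖fderiv ℝ v x‖ₑ with hJ
  -- inner estimate
  have main : ∀ a b : ℝ≥0, A < a → a < b → (b:ℝ≥0∞) < B →
      (b:ℝ≥0∞) ≤ a + C * (E2 (-(k * β)) * J) := by
    intro a b ha hab hb
    have ha0 : (0:ℝ) < a := by
      have : (0:ℝ≥0∞) < a := lt_of_le_of_lt (zero_le) ha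
      exact_mod_cast this
    have h := hC d v hv a b ha0 (by exact_mod_cast hab) (hfin a ha0)
    have h1 : E2 k ≤ volume {x | (b:ℝ) ≤ ‖v x‖} := by
      refine (lt_rearr hb).le.trans (measure_mono fun x hx => ?_)
      have hx' : (b:ℝ≥0∞) < ‖v x‖₊ := hx
      exact_mod_cast (ENNReal.coe_lt_coe.1 hx').le
    have h2 : ∫⁻ x in {x | (a:ℝ) < ‖v x‖ ∧ ‖v x‖ < b}, ‖fderiv ℝ v x‖ₑ ≤ J := by
      apply lintegral_mono_set
      rintro x ⟨hx1, hx2⟩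
      refine ⟨ha.trans ?_, lt_trans ?_ hb⟩
      · change (a:ℝ≥0∞) < (‖v x‖₊ : ℝ≥0∞)
        exact_mod_cast hx1
      · change (‖v x‖₊ : ℝ≥0∞) < (b:ℝ≥0∞)
        exact_mod_cast hx2
    have h3 : ENNReal.ofReal ((b:ℝ) - a) * E2 (k * β) ≤ C * J := by
      rw [← E2_rpow]
      calc _ ≤ ENNReal.ofReal ((b:ℝ) - a) * volume {x | (b:ℝ) ≤ ‖v x‖} ^ β := by gcongr
        _ ≤ _ := h
        _ ≤ _ := by gcongr
    have h4 : ENNReal.ofReal ((b:ℝ) - a) ≤ C * (E2 (-(k * β)) * J) := by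
      calc ENNReal.ofReal ((b:ℝ) - a) = E2 (-(k * β)) * (ENNReal.ofReal ((b:ℝ) - a) * E2 (k * β)) := by
            rw [mul_left_comm, E2_neg_mul, mul_one]
        _ ≤ E2 (-(k * β)) * (C * J) := by gcongr
        _ = _ := by ring
    calc (b:ℝ≥0∞) = a + ENNReal.ofReal ((b:ℝ) - a) := by
          have hba : (0:ℝ) ≤ (b:ℝ) - a := sub_nonneg.2 (by exact_mod_cast hab.le)
          rw [← ENNReal.ofReal_coe_nnreal (p := b), ← ENNReal.ofReal_coe_nnreal (p := a),
            ← ENNReal.ofReal_add (NNReal.coe_nonneg a) hba]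
          congr 1; ring
      _ ≤ _ := by gcongr
  refine le_of_forall_lt fun c hc => ?_
  obtain ⟨b, hcb, hbB⟩ := ENNReal.lt_iff_exists_nnreal_btwn.1 hc
  refine hcb.trans_le ?_
  rw [← tsub_le_iff_right]
  refine le_of_forall_gt fun a' ha' => ?_
  obtain ⟨a, haA, haa'⟩ := ENNReal.lt_iff_exists_nnreal_btwn.1 ha'
  refine lt_of_le_of_lt ?_ haa'
  rcases lt_or_ge a b with hab | hab
  · rw [tsub_le_iff_right]
    exact main a b haA hab hbB
  · exact tsub_le_self.trans (by exact_mod_cast hab)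

lemma disc_sum (n : ℕ) (hn : 2 ≤ n) : ∃ C : ℝ≥0, ∀ (d : ℕ)
    (v : EuclideanSpace ℝ (Fin n) → EuclideanSpace ℝ (Fin d)), ContDiff ℝ 1 v →
    (∀ l : ℝ, 0 < l → volume {x | l < ‖v x‖} < ∞) → ∀ k : ℤ,
    rearr2 volume (fun x => ‖v x‖ₑ) k ≤ ∑' i : ℕ,
      C * (E2 (-((k + i : ℤ) * (1 - 1 / (n:ℝ)))) *
        ∫⁻ x in {x | rearr2 volume (fun x => ‖v x‖ₑ) (k + i + 1) < ‖v x‖ₑ ∧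
          ‖v x‖ₑ < rearr2 volume (fun x => ‖v x‖ₑ) (k + i)}, ‖fderiv ℝ v x‖ₑ) := by
  obtain ⟨C, hC⟩ := disc n hn
  refine ⟨C, fun d v hv hfin k => ?_⟩
  set f : EuclideanSpace ℝ (Fin n) → ℝ≥0∞ := fun x => ‖v x‖ₑ with hf
  have hstep := hC d v hv hfin
  set T : ℤ → ℝ≥0∞ := fun k => C * (E2 (-(k * (1 - 1 / (n:ℝ)))) *
        ∫⁻ x in {x | rearr2 volume f (k + 1) < ‖v x‖ₑ ∧
          ‖v x‖ₑ < rearr2 volume f k}, ‖fderiv ℝ v x‖ₑ) with hT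
  change _ ≤ ∑' i : ℕ, T (k + i)
  have hN : ∀ N : ℕ, rearr2 volume f k ≤ rearr2 volume f (k + N) + ∑ i ∈ Finset.range N, T (k + i) := by
    intro N
    induction N with
    | zero => simp
    | succ N ih =>
      refine ih.trans ?_
      rw [Finset.sum_range_succ, add_comm _ (T (k + N)), ← add_assoc]
      gcongr
      have := hstep (k + N)
      push_cast
      rw [← add_assoc]
      exact this
  apply ENNReal.le_of_forall_pos_le_add
  intro ε hε _
  have hm := hfin ε (by exact_mod_cast hε)
  obtain ⟨N, hNN⟩ : ∃ N : ℕ, rearr2 volume f (k + N) ≤ ε := by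
    have hset : {x | (ε:ℝ≥0∞) < f x} = {x | (ε:ℝ) < ‖v x‖} := by
      ext x
      change (ε:ℝ≥0∞) < (‖v x‖₊ : ℝ≥0∞) ↔ _
      rw [ENNReal.coe_lt_coe, ← NNReal.coe_lt_coe, coe_nnnorm]
      rfl
    rcases eq_or_ne (volume {x | (ε:ℝ≥0∞) < f x}) 0 with h0 | h0
    · exact ⟨0, rearr2_le (by rw [h0]; exact zero_le)⟩
    · obtain ⟨i, hi⟩ := E2_small (ε := (volume {x | (ε:ℝ≥0∞) < f x})⁻¹)
        (by rw [hset]; exact ENNReal.inv_ne_zero.2 hm.ne) (-k)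
      refine ⟨i, rearr2_le ?_⟩
      rw [ENNReal.lt_inv_iff_lt_inv] at hi
      refine hi.le.trans (le_of_eq ?_)
      rw [show ((k + i : ℤ):ℝ) = -((-k - i : ℤ) : ℝ) by push_cast; ring]
      exact (ENNReal.eq_inv_of_mul_eq_one_left (E2_neg_mul _)).symm
  calc _ ≤ _ := hN N
    _ ≤ ε + ∑' i : ℕ, T (k + i) := by
      gcongr
      exact ENNReal.sum_le_tsum _
    _ = _ := add_comm _ _

lemma step_euc (n : ℕ) (hn : 2 ≤ n) (σ : ℝ) (q : ℝ≥0∞) (hσ : 1 / (n:ℝ) < σ)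
    (h : (σ < 1 ∧ 1 ≤ q) ∨ (σ = 1 ∧ q = 1)) : ∃ C : ℝ≥0∞, C ≠ ∞ ∧ ∀ (d : ℕ)
    (v : EuclideanSpace ℝ (Fin n) → EuclideanSpace ℝ (Fin d)), ContDiff ℝ 1 v →
    (∀ l : ℝ, 0 < l → volume {x | l < ‖v x‖} < ∞) →
    dn q (fun k => E2 (k * (σ - 1 / (n:ℝ))) * rearr2 volume (fun x => ‖v x‖ₑ) k) ≤
      C * dn q (fun k => E2 (k * σ) * rearr2 volume (fun x => ‖fderiv ℝ v x‖ₑ) k) := by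
  obtain ⟨C, hC⟩ := disc_sum n hn
  have hτ : 0 < σ - 1 / (n:ℝ) := by linarith
  have hgeo := geom_fin hτ
  have hgm : ∀ (d : ℕ) (v : EuclideanSpace ℝ (Fin n) → EuclideanSpace ℝ (Fin d)), ContDiff ℝ 1 v →
      Measurable fun x => ‖fderiv ℝ v x‖ₑ := fun d v hv =>
    (hv.continuous_fderiv one_ne_zero).enorm.measurable
  rcases h with ⟨hσ1, hq⟩ | ⟨rfl, rfl⟩
  · have hgeo2 := geom_fin (τ := 1 - σ) (by linarith)
    refine ⟨∑' z : ℕ × ℕ, (C * 2) * (E2 (-(z.1 * (σ - 1 / (n:ℝ)))) * E2 (-(z.2 * (1 - σ)))), ?_,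
      fun d v hv hfin => ?_⟩
    · rw [ENNReal.tsum_mul_left, ENNReal.tsum_prod']
      simp_rw [ENNReal.tsum_mul_left, ENNReal.tsum_mul_right]
      exact ENNReal.mul_ne_top (ENNReal.mul_ne_top ENNReal.coe_ne_top (by simp))
        (ENNReal.mul_ne_top hgeo hgeo2)
    · refine dn_young hq _ (fun z => (z.1:ℤ) - z.2) fun k => ?_
      set f : EuclideanSpace ℝ (Fin n) → ℝ≥0∞ := fun x => ‖v x‖ₑ with hf
      set G := rearr2 volume (fun x => ‖fderiv ℝ v x‖ₑ) with hG
      rw [ENNReal.tsum_prod']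
      calc _ ≤ E2 (k * (σ - 1 / (n:ℝ))) * ∑' i : ℕ,
            C * (E2 (-((k + i : ℤ) * (1 - 1 / (n:ℝ)))) *
              (2 * ∑' l : ℕ, E2 ((k + i - l : ℤ):ℝ) * G (k + i - l))) := by
            gcongr
            refine (hC d v hv hfin k).trans (ENNReal.tsum_le_tsum fun i => ?_)
            gcongr
            apply hardy_aux (hgm d v hv)
            refine (measure_mono (t := {x | rearr2 volume f (k + i + 1) < f x}) fun x hx => hx.1).trans ?_
            refine (meas_rearr2 f _).trans (le_of_eq ?_)
            push_cast
            rfl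
        _ = _ := by
            rw [← ENNReal.tsum_mul_left]
            congr 1
            ext i
            simp_rw [← ENNReal.tsum_mul_left]
            congr 1
            ext l
            have hkey : E2 (k * (σ - 1 / (n:ℝ))) * E2 (-((k + i : ℤ) * (1 - 1 / (n:ℝ)))) *
                E2 ((k + i - l : ℤ):ℝ) = E2 (-(i * (σ - 1 / (n:ℝ)))) * E2 (-(l * (1 - σ))) *
                  E2 ((k + (i - l) : ℤ) * σ) := by
              simp only [← E2_add]
              congr 1
              push_cast
              ring
            rw [show k + ((i:ℤ) - l) = k + i - l by ring] at hkey ⊢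
            calc _ = C * 2 * (E2 (k * (σ - 1 / (n:ℝ))) * E2 (-((k + i : ℤ) * (1 - 1 / (n:ℝ)))) *
                  E2 ((k + i - l : ℤ):ℝ)) * G (k + i - l) := by ring
              _ = _ := by rw [hkey]; ring
  · refine ⟨(C * 2) * ∑' i : ℕ, E2 (-(i * (1 - 1 / (n:ℝ)))),
      ENNReal.mul_ne_top (ENNReal.mul_ne_top ENNReal.coe_ne_top (by simp)) hgeo,
      fun d v hv hfin => ?_⟩
    set f : EuclideanSpace ℝ (Fin n) → ℝ≥0∞ := fun x => ‖v x‖ₑ with hf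
    have hfm : Measurable f := hv.continuous.enorm.measurable
    set G := rearr2 volume (fun x => ‖fderiv ℝ v x‖ₑ) with hG
    set S : ℤ → Set (EuclideanSpace ℝ (Fin n)) := fun k =>
      {x | rearr2 volume f (k + 1) < f x ∧ f x < rearr2 volume f k} with hS
    set J : ℤ → ℝ≥0∞ := fun k => ∫⁻ x in S k, ‖fderiv ℝ v x‖ₑ with hJ
    have hSm : ∀ k, MeasurableSet (S k) := fun k =>
      (measurableSet_lt measurable_const hfm).inter (measurableSet_lt hfm measurable_const)
    have hSd : Pairwise (Function.onFun Disjoint S) := by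
      have hlt : ∀ i j : ℤ, i < j → Disjoint (S i) (S j) := by
        intro i j hij
        rw [Set.disjoint_left]
        intro x hx hx'
        have : rearr2 volume f j ≤ rearr2 volume f (i + 1) := rearr2_anti f (by omega)
        exact absurd (hx'.2.trans_le (this.trans hx.1.le)) (lt_irrefl _)
      intro i j hij
      rcases lt_or_gt_of_ne hij with h | h
      · exact hlt i j h
      · exact (hlt j i h).symm
    have hJs : ∑' k, J k ≤ 2 * ∑' k : ℤ, E2 k * G k := by
      rw [ENNReal.tsum_eq_iSup_sum]
      refine iSup_le fun s => ?_
      obtain ⟨N, hN⟩ : ∃ N : ℤ, ∀ k ∈ s, k ≤ N := by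
        obtain ⟨N, hN⟩ := s.bddAbove
        exact ⟨N, fun k hk => hN hk⟩
      simp only [hJ]
      rw [← lintegral_biUnion_finset (fun i _ j _ hij => hSd hij) (fun k _ => hSm k)]
      refine (hardy_aux (hgm d v hv) N ?_).trans ?_
      · refine (measure_mono (t := {x | rearr2 volume f (N + 1) < f x}) ?_).trans
          ((meas_rearr2 f (N + 1)).trans (le_of_eq (by push_cast; rfl)))
        intro x hx
        obtain ⟨k, hk, hxk⟩ := mem_iUnion₂.1 hx
        exact (rearr2_anti f (by have := hN k hk; omega)).trans_lt hxk.1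
      · gcongr
        exact ENNReal.tsum_comp_le_tsum_of_injective (f := fun i : ℕ => N - (i:ℤ))
          (fun i j hij => by simpa using hij) (fun k : ℤ => E2 k * G k)
    simp only [dn, ENNReal.one_ne_top, if_false, ENNReal.toReal_one, ENNReal.rpow_one, div_one, mul_one]
    calc _ ≤ ∑' k : ℤ, ∑' i : ℕ, C * (E2 (-(i * (1 - 1 / (n:ℝ)))) * J (k + i)) := by
          refine ENNReal.tsum_le_tsum fun k => ?_
          calc _ ≤ E2 (k * (1 - 1 / (n:ℝ))) * ∑' i : ℕ,
                C * (E2 (-((k + i : ℤ) * (1 - 1 / (n:ℝ)))) * J (k + i)) := by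
                gcongr
                exact hC d v hv hfin k
            _ = _ := by
                rw [← ENNReal.tsum_mul_left]
                congr 1
                ext i
                have hkey : E2 (k * (1 - 1 / (n:ℝ))) * E2 (-((k + i : ℤ) * (1 - 1 / (n:ℝ)))) =
                    E2 (-(i * (1 - 1 / (n:ℝ)))) := by
                  rw [← E2_add]
                  congr 1
                  push_cast
                  ring
                rw [← hkey]
                ring
      _ = C * ((∑' i : ℕ, E2 (-(i * (1 - 1 / (n:ℝ))))) * ∑' k, J k) := by
          rw [ENNReal.tsum_comm]
          simp_rw [ENNReal.tsum_mul_left]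
          congr 1
          rw [← ENNReal.tsum_mul_right]
          congr 1
          ext i
          congr 1
          exact (Equiv.addRight (i:ℤ)).tsum_eq J
      _ ≤ C * ((∑' i : ℕ, E2 (-(i * (1 - 1 / (n:ℝ))))) * (2 * ∑' k : ℤ, E2 k * G k)) := by gcongr
      _ = _ := by ring


/-- The step inequality for maps into an arbitrary finite-dimensional space. -/
lemma step_fin (n : ℕ) (F : Type) [NormedAddCommGroup F] [NormedSpace ℝ F] [FiniteDimensional ℝ F]
    (σ : ℝ) (q : ℝ≥0∞) (hq : 1 ≤ q)
    (hE : ∃ C : ℝ≥0∞, C ≠ ∞ ∧ ∀ d (v : EuclideanSpace ℝ (Fin n) → EuclideanSpace ℝ (Fin d)),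
      ContDiff ℝ 1 v → (∀ l:ℝ, 0<l → volume {x | l < ‖v x‖} < ∞) →
      dn q (fun k => E2 (k*(σ - 1/(n:ℝ))) * rearr2 volume (fun x => ‖v x‖ₑ) k) ≤
        C * dn q (fun k => E2 (k*σ) * rearr2 volume (fun x => ‖fderiv ℝ v x‖ₑ) k)) :
    ∃ C : ℝ≥0∞, C ≠ ∞ ∧ ∀ (v : EuclideanSpace ℝ (Fin n) → F),
      ContDiff ℝ 1 v → (∀ l:ℝ, 0<l → volume {x | l < ‖v x‖} < ∞) →
      dn q (fun k => E2 (k*(σ - 1/(n:ℝ))) * rearr2 volume (fun x => ‖v x‖ₑ) k) ≤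
        C * dn q (fun k => E2 (k*σ) * rearr2 volume (fun x => ‖fderiv ℝ v x‖ₑ) k) := by
  obtain ⟨C, hC, H⟩ := hE
  let T : F ≃L[ℝ] EuclideanSpace ℝ (Fin (Module.finrank ℝ F)) := toEuclidean
  let A : F →L[ℝ] EuclideanSpace ℝ (Fin (Module.finrank ℝ F)) := T
  let B : EuclideanSpace ℝ (Fin (Module.finrank ℝ F)) →L[ℝ] F := T.symm
  have hBA : ∀ y, B (A y) = y := fun y => T.symm_apply_apply y
  refine ⟨(‖B‖₊ : ℝ≥0∞) * (C * (‖A‖₊ : ℝ≥0∞)), ?_, ?_⟩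
  · exact ENNReal.mul_ne_top ENNReal.coe_ne_top (ENNReal.mul_ne_top hC ENNReal.coe_ne_top)
  intro v hv hfin
  have h1 := H _ (fun x => A (v x)) (A.contDiff.comp hv) (by
    intro l hl
    have hA : 0 < ‖A‖ + 1 := by positivity
    refine lt_of_le_of_lt (measure_mono ?_) (hfin (l / (‖A‖ + 1)) (by positivity))
    intro x hx
    have hx : l < ‖A (v x)‖ := hx
    change l / (‖A‖ + 1) < ‖v x‖
    rw [div_lt_iff₀ hA]
    have := A.le_opNorm (v x)
    nlinarith [norm_nonneg (v x)])
  have h2 : dn q (fun k => E2 (k*(σ - 1/(n:ℝ))) * rearr2 volume (fun x => ‖v x‖ₑ) k) ≤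
      (‖B‖₊ : ℝ≥0∞) * dn q (fun k => E2 (k*(σ - 1/(n:ℝ))) *
        rearr2 volume (fun x => ‖A (v x)‖ₑ) k) := by
    refine dn_const hq _ 0 fun k => ?_
    rw [add_zero, mul_left_comm]
    gcongr
    refine rearr_le _ (fun x => ?_) _
    change (‖v x‖₊ : ℝ≥0∞) ≤ ‖B‖₊ * (‖A (v x)‖₊ : ℝ≥0∞)
    have := B.le_opNNNorm (A (v x))
    rw [hBA] at this
    exact_mod_cast this
  have h3 : dn q (fun k => E2 (k*σ) * rearr2 volume (fun x => ‖fderiv ℝ (fun x => A (v x)) x‖ₑ) k) ≤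
      (‖A‖₊ : ℝ≥0∞) * dn q (fun k => E2 (k*σ) *
        rearr2 volume (fun x => ‖fderiv ℝ v x‖ₑ) k) := by
    refine dn_const hq _ 0 fun k => ?_
    rw [add_zero, mul_left_comm]
    gcongr
    refine rearr_le _ (fun x => ?_) _
    have hd : fderiv ℝ (fun x => A (v x)) x = A.comp (fderiv ℝ v x) :=
      (A.hasFDerivAt.comp x ((hv.differentiable one_ne_zero) x).hasFDerivAt).fderiv
    rw [hd]
    change (‖A.comp (fderiv ℝ v x)‖₊ : ℝ≥0∞) ≤ ‖A‖₊ * (‖fderiv ℝ v x‖₊ : ℝ≥0∞)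
    exact_mod_cast A.opNNNorm_comp_le (fderiv ℝ v x)
  calc _ ≤ _ := h2
    _ ≤ (‖B‖₊ : ℝ≥0∞) * (C * ((‖A‖₊ : ℝ≥0∞) * _)) := by
        gcongr
        exact h1.trans (by gcongr)
    _ = _ := by ring

lemma finDim_cmm (n k : ℕ) :
    FiniteDimensional ℝ (EuclideanSpace ℝ (Fin n) [×k]→L[ℝ] ℝ) := by
  let f : (EuclideanSpace ℝ (Fin n) [×k]→L[ℝ] ℝ) →ₗ[ℝ]
      MultilinearMap ℝ (fun _ : Fin k => EuclideanSpace ℝ (Fin n)) ℝ :=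
    ContinuousMultilinearMap.toMultilinearMapLinear
  exact FiniteDimensional.of_injective f ContinuousMultilinearMap.toMultilinearMap_injective

lemma step_iter (n : ℕ) (hn : 2 ≤ n) (σ : ℝ) (q : ℝ≥0∞) (hσ : 1/(n:ℝ) < σ)
    (hc : (σ < 1 ∧ 1 ≤ q) ∨ (σ = 1 ∧ q = 1)) (j : ℕ) :
    ∃ C : ℝ≥0∞, C ≠ ∞ ∧ ∀ (u : EuclideanSpace ℝ (Fin n) → ℝ),
      ContDiff ℝ ((j+1 : ℕ) : ℕ∞) u →
      (∀ l:ℝ, 0<l → volume {x | l < ‖iteratedFDeriv ℝ j u x‖} < ∞) →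
      dn q (fun k => E2 (k*(σ - 1/(n:ℝ))) *
        rearr2 volume (fun x => ‖iteratedFDeriv ℝ j u x‖ₑ) k) ≤
        C * dn q (fun k => E2 (k*σ) *
          rearr2 volume (fun x => ‖iteratedFDeriv ℝ (j+1) u x‖ₑ) k) := by
  have hq : 1 ≤ q := by rcases hc with h | h; exacts [h.2, h.2.ge]
  haveI := finDim_cmm n j
  obtain ⟨C, hC, H⟩ := step_fin n (EuclideanSpace ℝ (Fin n) [×j]→L[ℝ] ℝ) σ q hq
    (step_euc n hn σ q hσ hc)
  refine ⟨C, hC, fun u hu hfin => ?_⟩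
  have h1 : ContDiff ℝ 1 (iteratedFDeriv ℝ j u) :=
    hu.iteratedFDeriv_right (by norm_cast; omega)
  have := H _ h1 hfin
  have he : (fun x => ‖fderiv ℝ (iteratedFDeriv ℝ j u) x‖ₑ) =
      fun x => ‖iteratedFDeriv ℝ (j+1) u x‖ₑ := by
    funext x
    rw [← ofReal_norm_eq_enorm, ← ofReal_norm_eq_enorm, norm_fderiv_iteratedFDeriv]
  rw [he] at this
  exact this

lemma iter_all (n m : ℕ) (hn : 2 ≤ n) (hm : 1 ≤ m) (hmn : m < n)
    (p : ℝ) (q : ℝ≥0∞)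
    (hcase : (1 < p ∧ p < (n : ℝ)/(m : ℝ) ∧ 1 ≤ q) ∨ (p = 1 ∧ q = 1)) (j : ℕ) (hj : j ≤ m) :
    ∃ C : ℝ≥0∞, C ≠ ∞ ∧ ∀ (u : EuclideanSpace ℝ (Fin n) → ℝ),
      ContDiff ℝ (m : ℕ∞) u → DecaysAtInfinity n m u →
      dn q (fun k => E2 (k*(1/p - m/(n:ℝ))) *
        rearr2 volume (fun x => ‖iteratedFDeriv ℝ 0 u x‖ₑ) k) ≤
        C * dn q (fun k => E2 (k*(1/p - ((m:ℝ) - j)/(n:ℝ))) *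
          rearr2 volume (fun x => ‖iteratedFDeriv ℝ j u x‖ₑ) k) := by
  induction j with
  | zero => exact ⟨1, ENNReal.one_ne_top, fun u _ _ => by simp⟩
  | succ j ih =>
    obtain ⟨C, hC, H⟩ := ih (by omega)
    have hn0 : (0:ℝ) < n := by exact_mod_cast (by omega : 0 < n)
    have hm0 : (0:ℝ) < m := by exact_mod_cast hm
    have hmp : (m:ℝ)/n < 1/p := by
      rcases hcase with ⟨h1, h2, -⟩ | ⟨h1, -⟩
      · rw [div_lt_div_iff₀ hn0 (by linarith)]
        rw [lt_div_iff₀ hm0] at h2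
        linarith
      · rw [h1, div_one, div_lt_one hn0]; exact_mod_cast hmn
    have hj1 : ((j:ℝ) + 1) ≤ m := by exact_mod_cast hj
    have hσ : 1/(n:ℝ) < 1/p - ((m:ℝ) - ((j+1:ℕ):ℝ))/(n:ℝ) := by
      have e : ((m:ℝ) - ((j+1:ℕ):ℝ))/(n:ℝ) = m/n - (j/n + 1/n) := by push_cast; ring
      have : (0:ℝ) ≤ j/n := by positivity
      rw [e]; linarith
    have hpos : 0 ≤ ((m:ℝ) - ((j+1:ℕ):ℝ))/(n:ℝ) :=
      div_nonneg (by push_cast; linarith) hn0.le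
    have hc : ((1/p - ((m:ℝ) - ((j+1:ℕ):ℝ))/(n:ℝ)) < 1 ∧ 1 ≤ q) ∨
        ((1/p - ((m:ℝ) - ((j+1:ℕ):ℝ))/(n:ℝ)) = 1 ∧ q = 1) := by
      rcases hcase with ⟨h1, -, h3⟩ | ⟨h1, h2⟩
      · left
        have : 1/p < 1 := by rw [div_lt_one (by linarith)]; exact h1
        exact ⟨by linarith, h3⟩
      · rcases hpos.eq_or_lt with h | h
        · right; rw [← h, h1]; exact ⟨by norm_num, h2⟩
        · left; rw [h1]; exact ⟨by linarith, h2.ge⟩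
    obtain ⟨D, hD, K⟩ := step_iter n hn _ q hσ hc j
    refine ⟨C * D, ENNReal.mul_ne_top hC hD, fun u hu hdec => ?_⟩
    have h1 := H u hu hdec
    have h2 := K u (hu.of_le (by exact_mod_cast hj)) (hdec j (by omega))
    have e : 1/p - ((m:ℝ) - ((j+1:ℕ):ℝ))/(n:ℝ) - 1/(n:ℝ) = 1/p - ((m:ℝ) - j)/(n:ℝ) := by
      push_cast; ring
    rw [e] at h2
    rw [mul_assoc]
    exact h1.trans (by gcongr)


/-- sharp higher-order Sobolev inequality into Lorentz spaces,
Peetre–O'Neil type. -/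
theorem statement11 (n m : ℕ) (hn : 2 ≤ n) (hm : 1 ≤ m) (hmn : m < n)
    (p : ℝ) (q : ℝ≥0∞)
    (hcase : (1 < p ∧ p < (n : ℝ)/(m : ℝ) ∧ 1 ≤ q) ∨ (p = 1 ∧ q = 1)) :
    ∃ C : ℝ≥0∞, 0 < C ∧ C < ∞ ∧
      ∀ u : EuclideanSpace ℝ (Fin n) → ℝ, ContDiff ℝ (m : ℕ∞) u → DecaysAtInfinity n m u →
        Lqnorm q (Set.Ioi 0)
            (fun t => ENNReal.ofReal (t ^ (1/p - (m : ℝ)/(n : ℝ) - q⁻¹.toReal)) *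
              rearrangement volume (fun x => ENNReal.ofReal |u x|) t)
          ≤ C * Lqnorm q (Set.Ioi 0)
            (fun t => ENNReal.ofReal (t ^ (1/p - q⁻¹.toReal)) *
              rearrangement volume (fun x => ENNReal.ofReal ‖iteratedFDeriv ℝ m u x‖) t) := by
  have hq : 1 ≤ q := by rcases hcase with h | h; exacts [h.2.2, h.2.ge]
  obtain ⟨C, hC, H⟩ := iter_all n m hn hm hmn p q hcase m le_rfl
  obtain ⟨C1, H1⟩ := cmp_upper q hq (1/p - (m:ℝ)/(n:ℝ))
  obtain ⟨C2, H2⟩ := cmp_lower q hq (1/p)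
  refine ⟨C1 * (C * C2) + 1, by positivity, ?_, ?_⟩
  · exact ENNReal.add_lt_top.2 ⟨ENNReal.mul_lt_top ENNReal.coe_lt_top
      (ENNReal.mul_lt_top hC.lt_top ENNReal.coe_lt_top), ENNReal.one_lt_top⟩
  intro u hu hdec
  have e0 : (fun x => ENNReal.ofReal |u x|) = fun x => ‖iteratedFDeriv ℝ 0 u x‖ₑ := by
    funext x
    rw [← ofReal_norm_eq_enorm, norm_iteratedFDeriv_zero, Real.norm_eq_abs]
  have em : (fun x => ENNReal.ofReal ‖iteratedFDeriv ℝ m u x‖) =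
      fun x => ‖iteratedFDeriv ℝ m u x‖ₑ := by
    funext x
    rw [← ofReal_norm_eq_enorm]
  rw [e0, em]
  have h := H u hu hdec
  rw [sub_self, zero_div, sub_zero] at h
  have h1 := H1 (rearrangement volume (fun x => ‖iteratedFDeriv ℝ 0 u x‖ₑ)) (rearr_anti _)
  have h2 := H2 (rearrangement volume (fun x => ‖iteratedFDeriv ℝ m u x‖ₑ)) (rearr_anti _)
  refine h1.trans ?_
  refine (mul_le_mul_right (h.trans (mul_le_mul_right h2 C)) (C1 : ℝ≥0∞)).trans ?_
  rw [add_mul, ← mul_assoc C, ← mul_assoc (C1 : ℝ≥0∞)]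
  exact le_self_add

end
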